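/- arXiv:math/9809170 — 2 statements merged into one kernel-verified Lean document; each statement's English description precedes it below -/
import Mathlib

section
/- Let R̂ and F̂ be compatible R-matrices on V⊗V. Then the twisted operator R̂^F := F̂ R̂ F̂^{-1} satisfies the Yang–Baxter equation (R̂^F)₁(R̂^F)₂(R̂^F)₁ = (R̂^F)₂(R̂^F)₁(R̂^F)₂ on V^{⊗3}, and the pair (R̂^F, F̂) is again a pair of compatible R-matrices. -/
/-! Common definitions for quantum matrix algebras `M(R̂,F̂)` in the sense of
Isaev–Ogievetsky–Pyatov, "On quantum matrix algebras satisfying the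
Cayley-Hamilton-Newton identities".

We model operators on `V^{⊗m}` (where `dim V = N`) as matrices indexed by
multi-indices `Fin m → Fin N`; entries are taken in a (possibly
noncommutative) unital associative algebra `A` over a field `K`.
Sites (tensor factors) are numbered starting from `0`, so the paper's
`X_i` is `site m (i-1) X`, and the paper's `M_{\overline{k}}` is
`Mbar m F F⁻¹ M (k-1)`. -/

namespace CHN

noncomputable section

/-- Operators on `V^{⊗m}` (`dim V = N`) with entries in a ring `A`. -/
abbrev Op (N : ℕ) (A : Type*) [Ring A] (m : ℕ) :=
  Matrix (Fin m → Fin N) (Fin m → Fin N) A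

/-- Operators on `V ⊗ V`. -/
abbrev M2 (N : ℕ) (A : Type*) [Ring A] :=
  Matrix (Fin N × Fin N) (Fin N × Fin N) A

/-- `site m i X` places the two-site operator `X` at the (0-based) tensor
factors `i, i+1` of `V^{⊗m}`, acting as the identity elsewhere.  In the
paper's 1-based notation, `X_i = site m (i-1) X`.  (Out of range it is the
identity.) -/
def site {A : Type*} [Ring A] {N : ℕ} (m i : ℕ) (X : M2 N A) : Op N A m :=
  fun a b =>
    if h : i + 1 < m then
      X (a ⟨i, Nat.lt_of_succ_lt h⟩, a ⟨i + 1, h⟩)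
          (b ⟨i, Nat.lt_of_succ_lt h⟩, b ⟨i + 1, h⟩) *
        (if ∀ j : Fin m, (j : ℕ) ≠ i → (j : ℕ) ≠ i + 1 → a j = b j then 1 else 0)
    else if a = b then 1 else 0

/-- `site1 m i X` places the one-site operator `X` at the (0-based) factor `i`. -/
def site1 {A : Type*} [Ring A] {N : ℕ} (m i : ℕ) (X : Matrix (Fin N) (Fin N) A) :
    Op N A m :=
  fun a b =>
    if h : i < m then
      X (a ⟨i, h⟩) (b ⟨i, h⟩) *
        (if ∀ j : Fin m, (j : ℕ) ≠ i → a j = b j then 1 else 0)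
    else if a = b then 1 else 0

/-- `chain m X i l = X_i X_{i+1} ⋯ X_{i+l-1}` (0-based sites, `l` factors); in
the paper's 1-based notation this is `X_{i+1 → i+l}`. -/
def chain {A : Type*} [Ring A] {N : ℕ} (m : ℕ) (X : M2 N A) (i : ℕ) :
    ℕ → Op N A m
  | 0 => 1
  | l + 1 => chain m X i l * site m (i + l) X

/-- The Yang–Baxter equation `X₁X₂X₁ = X₂X₁X₂` on `V^{⊗3}`. -/
def YB {A : Type*} [Ring A] {N : ℕ} (X : M2 N A) : Prop :=
  site 3 0 X * site 3 1 X * site 3 0 X = site 3 1 X * site 3 0 X * site 3 1 X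

/-- Compatibility of a pair of R-matrices: both Yang–Baxter equations together
with the conditions `R̂₁F̂₂F̂₁ = F̂₂F̂₁R̂₂` and `F̂₁F̂₂R̂₁ = R̂₂F̂₁F̂₂` on `V^{⊗3}`. -/
def Compatible {A : Type*} [Ring A] {N : ℕ} (R F : M2 N A) : Prop :=
  YB R ∧ YB F ∧
    site 3 0 R * site 3 1 F * site 3 0 F = site 3 1 F * site 3 0 F * site 3 1 R ∧
    site 3 0 F * site 3 1 F * site 3 0 R = site 3 1 R * site 3 0 F * site 3 1 F

/-- `Ψ` witnesses closedness of `F̂`:  `Ψ^{af}_{cg} F̂^{gb}_{fd} = δ^a_d δ^b_c`. -/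
def IsClosedPair {A : Type*} [Ring A] {N : ℕ} (F Ψ : M2 N A) : Prop :=
  ∀ a b c d : Fin N,
    (∑ f : Fin N, ∑ g : Fin N, Ψ (a, f) (c, g) * F (g, b) (f, d)) =
      if a = d ∧ b = c then 1 else 0

/-- The matrix `D`, `D^a_b := Ψ^{ac}_{bc}`. -/
def Dmat {A : Type*} [Ring A] {N : ℕ} (Ψ : M2 N A) : Matrix (Fin N) (Fin N) A :=
  fun a b => ∑ c : Fin N, Ψ (a, c) (b, c)

/-- Quantum trace (with weight `D`) over the last tensor factor. -/
def qtr1 {K : Type*} [Field K] {A : Type*} [Ring A] [Algebra K A] {N m : ℕ}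
    (D : Matrix (Fin N) (Fin N) K) (X : Op N A (m + 1)) : Op N A m :=
  fun a b => ∑ c : Fin N, ∑ e : Fin N,
    algebraMap K A (D c e) * X (Fin.snoc a e) (Fin.snoc b c)

/-- Quantum trace over the last `j` tensor factors. -/
def qtrs {K : Type*} [Field K] {A : Type*} [Ring A] [Algebra K A] {N : ℕ}
    (D : Matrix (Fin N) (Fin N) K) (m : ℕ) :
    (j : ℕ) → Op N A (m + j) → Op N A m
  | 0, X => X
  | j + 1, X => qtrs D m j (qtr1 D X)

/-- Full quantum trace `Tr_F(1,…,m)`, with values in `A`. -/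
def qtrAll {K : Type*} [Field K] {A : Type*} [Ring A] [Algebra K A] {N m : ℕ}
    (D : Matrix (Fin N) (Fin N) K) (X : Op N A m) : A :=
  ∑ a : Fin m → Fin N, ∑ b : Fin m → Fin N,
    algebraMap K A (∏ i, D (a i) (b i)) * X b a

/-- Quantum trace of a one-site operator:  `Tr_F X = Tr (D X)`. -/
def trF {K : Type*} [Field K] {A : Type*} [Ring A] [Algebra K A] {N : ℕ}
    (D : Matrix (Fin N) (Fin N) K) (X : Matrix (Fin N) (Fin N) A) : A :=
  ∑ a : Fin N, ∑ b : Fin N, algebraMap K A (D a b) * X b a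

/-- Ordinary partial trace over the last tensor factor. -/
def ptr1 {A : Type*} [Ring A] {N m : ℕ} (X : Op N A (m + 1)) : Op N A m :=
  fun a b => ∑ c : Fin N, X (Fin.snoc a c) (Fin.snoc b c)

/-- Ordinary partial trace over the last `j` tensor factors. -/
def ptrs {A : Type*} [Ring A] {N : ℕ} (m : ℕ) :
    (j : ℕ) → Op N A (m + j) → Op N A m
  | 0, X => X
  | j + 1, X => ptrs m j (ptr1 X)

/-- `Mbar m F Finv M k` is the paper's `M_{\overline{k+1}}` (0-based index `k`):
`M_{\overline{1}} := M₁` and `M_{\overline{k+1}} := F̂_k M_{\overline{k}} F̂_k⁻¹`. -/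
def Mbar {A : Type*} [Ring A] {N : ℕ} (m : ℕ) (F Finv : M2 N A)
    (M : Matrix (Fin N) (Fin N) A) : ℕ → Op N A m
  | 0 => site1 m 0 M
  | k + 1 => site m k F * Mbar m F Finv M k * site m k Finv

/-- `MbarSeg m F Finv M i l = M_{\overline{i+1}} M_{\overline{i+2}} ⋯ M_{\overline{i+l}}`,
the ordered product of `l` consecutive copies starting at 0-based index `i`.
In particular `MbarSeg m F Finv M 0 k = M_{\overline{1}} ⋯ M_{\overline{k}}`. -/
def MbarSeg {A : Type*} [Ring A] {N : ℕ} (m : ℕ) (F Finv : M2 N A)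
    (M : Matrix (Fin N) (Fin N) A) (i : ℕ) : ℕ → Op N A m
  | 0 => 1
  | l + 1 => MbarSeg m F Finv M i l * Mbar m F Finv M (i + l)

/-- The double twist `R̂^{FF} = F̂ (F̂ R̂ F̂⁻¹) F̂⁻¹`. -/
def RFF {K : Type*} [Field K] {N : ℕ} (R F : M2 N K) : M2 N K :=
  F * (F * R * F⁻¹) * F⁻¹

/-- `M` is a matrix of generators of the algebra `M(R̂,F̂)`:
`R̂₁ M_{\overline{1}} M_{\overline{2}} = M_{\overline{1}} M_{\overline{2}} (R̂^{FF})₁`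
on `V ⊗ V`. -/
def IsGenerators {K : Type*} [Field K] {A : Type*} [Ring A] [Algebra K A] {N : ℕ}
    (R F : M2 N K) (M : Matrix (Fin N) (Fin N) A) : Prop :=
  site 2 0 (R.map (algebraMap K A)) *
      MbarSeg 2 (F.map (algebraMap K A)) ((F⁻¹).map (algebraMap K A)) M 0 2 =
    MbarSeg 2 (F.map (algebraMap K A)) ((F⁻¹).map (algebraMap K A)) M 0 2 *
      site 2 0 ((RFF R F).map (algebraMap K A))

/-- Evaluation of a noncommutative polynomial `Y` in `v` variables, substituting
for the variable `x_j` the operator `R̂` placed at the (0-based) sites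
`p+j, p+j+1` of `V^{⊗m}`.  For `p = 0` this is the paper's
`Y^{(v+1)} = Y^{(v+1)}(R̂₁,…,R̂_v)`, and a general `p` gives `Y^{(p+1,v+1)}`. -/
def evalY {K : Type*} [Field K] {A : Type*} [Ring A] [Algebra K A] {N m v : ℕ}
    (R : M2 N A) (p : ℕ) (Y : FreeAlgebra K (Fin v)) : Op N A m :=
  FreeAlgebra.lift K (fun j : Fin v => site m (p + (j : ℕ)) R) Y

/-- `Ustack m R k l = R̂_{l → l+k-1} ⋯ R̂_{2 → k+1} R̂_{1 → k}` (1-based labels):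
the product of `l` descending chains of length `k`. -/
def Ustack {A : Type*} [Ring A] {N : ℕ} (m : ℕ) (R : M2 N A) (k : ℕ) :
    ℕ → Op N A m
  | 0 => 1
  | l + 1 => chain m R l k * Ustack m R k l

/-- The `q`-number `n_q = (qⁿ − q⁻ⁿ)/(q − q⁻¹)`. -/
def qInt {K : Type*} [Field K] (q : K) (n : ℕ) : K :=
  (q ^ n - q⁻¹ ^ n) / (q - q⁻¹)

/-- `R̂` is a Hecke R-matrix for the parameter `q`:  it is invertible, satisfies
the Yang–Baxter equation and the Hecke condition `R̂² = 1 + (q − q⁻¹)R̂`. -/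
def IsHecke {K : Type*} [Field K] {N : ℕ} (q : K) (R : M2 N K) : Prop :=
  IsUnit R ∧ YB R ∧ R * R = 1 + (q - q⁻¹) • R

/-- The `q`-antisymmetrizer `A^{(k)}` built from `R̂`, placed at the (0-based)
tensor factors `p, p+1, …, p+k-1` of `V^{⊗m}`. -/
def qasym {K : Type*} [Field K] {N : ℕ} (q : K) (R : M2 N K) (m p : ℕ) :
    ℕ → Op N K m
  | 0 => 1
  | 1 => 1
  | k + 2 =>
      (qInt q (k + 2))⁻¹ •
        (qasym q R m p (k + 1) *
          (q ^ (k + 1) • (1 : Op N K m) - qInt q (k + 1) • site m (p + k) R) *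
          qasym q R m p (k + 1))

/-- The `q`-symmetrizer `S^{(k)}` built from `R̂`, placed at the (0-based)
tensor factors `p, p+1, …, p+k-1` of `V^{⊗m}`. -/
def qsym {K : Type*} [Field K] {N : ℕ} (q : K) (R : M2 N K) (m p : ℕ) :
    ℕ → Op N K m
  | 0 => 1
  | 1 => 1
  | k + 2 =>
      (qInt q (k + 2))⁻¹ •
        (qsym q R m p (k + 1) *
          (q⁻¹ ^ (k + 1) • (1 : Op N K m) + qInt q (k + 1) • site m (p + k) R) *
          qsym q R m p (k + 1))

/-- The elementary symmetric function
`σ_k(M) = Tr_F(1,…,k)(A^{(k)} M_{\overline{1}}⋯M_{\overline{k}})` (with `σ_0 = 1`). -/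
def sigmaF {K : Type*} [Field K] {A : Type*} [Ring A] [Algebra K A] {N : ℕ}
    (q : K) (R F Ψ : M2 N K) (M : Matrix (Fin N) (Fin N) A) (k : ℕ) : A :=
  qtrAll (Dmat Ψ)
    ((qasym q R k 0 k).map (algebraMap K A) *
      MbarSeg k (F.map (algebraMap K A)) ((F⁻¹).map (algebraMap K A)) M 0 k)

/-- The complete symmetric function
`τ_k(M) = Tr_F(1,…,k)(S^{(k)} M_{\overline{1}}⋯M_{\overline{k}})` (with `τ_0 = 1`). -/
def tauF {K : Type*} [Field K] {A : Type*} [Ring A] [Algebra K A] {N : ℕ}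
    (q : K) (R F Ψ : M2 N K) (M : Matrix (Fin N) (Fin N) A) (k : ℕ) : A :=
  qtrAll (Dmat Ψ)
    ((qsym q R k 0 k).map (algebraMap K A) *
      MbarSeg k (F.map (algebraMap K A)) ((F⁻¹).map (algebraMap K A)) M 0 k)

/-- The power sums `s_k(M) = Tr_F(1,…,k)(R̂_{1→k−1} M_{\overline{1}}⋯M_{\overline{k}})`,
with `s_0 = 1`. -/
def sF {K : Type*} [Field K] {A : Type*} [Ring A] [Algebra K A] {N : ℕ}
    (R F Ψ : M2 N K) (M : Matrix (Fin N) (Fin N) A) : ℕ → A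
  | 0 => 1
  | j + 1 =>
      qtrAll (Dmat Ψ)
        (chain (j + 1) (R.map (algebraMap K A)) 0 j *
          MbarSeg (j + 1) (F.map (algebraMap K A)) ((F⁻¹).map (algebraMap K A)) M 0 (j + 1))

/-- The `(j+1)`-st quantum power of `M`,
`M^{\overline{j+1}} = Tr_F(2,…,j+1)(R̂_{1→j} M_{\overline{1}}⋯M_{\overline{j+1}})`,
as a one-site operator (so `MpowF R F Ψ M 0 = M₁ = M`). -/
def MpowF {K : Type*} [Field K] {A : Type*} [Ring A] [Algebra K A] {N : ℕ}
    (R F Ψ : M2 N K) (M : Matrix (Fin N) (Fin N) A) (j : ℕ) : Op N A 1 :=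
  qtrs (Dmat Ψ) 1 j
    (chain (1 + j) (R.map (algebraMap K A)) 0 j *
      MbarSeg (1 + j) (F.map (algebraMap K A)) ((F⁻¹).map (algebraMap K A)) M 0 (j + 1))

/-- The `(j+1)`-st wedge power of `M`,
`M^{∧(j+1)} = Tr_F(2,…,j+1)(A^{(j+1)} M_{\overline{1}}⋯M_{\overline{j+1}})`. -/
def MwedgeF {K : Type*} [Field K] {A : Type*} [Ring A] [Algebra K A] {N : ℕ}
    (q : K) (R F Ψ : M2 N K) (M : Matrix (Fin N) (Fin N) A) (j : ℕ) : Op N A 1 :=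
  qtrs (Dmat Ψ) 1 j
    ((qasym q R (1 + j) 0 (j + 1)).map (algebraMap K A) *
      MbarSeg (1 + j) (F.map (algebraMap K A)) ((F⁻¹).map (algebraMap K A)) M 0 (j + 1))

/-- The `(j+1)`-st symmetric power of `M`,
`M^{S(j+1)} = Tr_F(2,…,j+1)(S^{(j+1)} M_{\overline{1}}⋯M_{\overline{j+1}})`. -/
def MsymF {K : Type*} [Field K] {A : Type*} [Ring A] [Algebra K A] {N : ℕ}
    (q : K) (R F Ψ : M2 N K) (M : Matrix (Fin N) (Fin N) A) (j : ℕ) : Op N A 1 :=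
  qtrs (Dmat Ψ) 1 j
    ((qsym q R (1 + j) 0 (j + 1)).map (algebraMap K A) *
      MbarSeg (1 + j) (F.map (algebraMap K A)) ((F⁻¹).map (algebraMap K A)) M 0 (j + 1))

/-- `M^{\overline{0}} := q^{-n} n_q Tr_{(2,…,n)}(A^{(n)}) D^{-1}`, with `n = n0 + 1`
(an ordinary, non-quantum, trace over the factors `2,…,n`). -/
def MzeroF {K : Type*} [Field K] {N : ℕ} (q : K) (R Ψ : M2 N K) (n0 : ℕ) :
    Op N K 1 :=
  (q⁻¹ ^ (n0 + 1) * qInt q (n0 + 1)) •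
    (ptrs 1 n0 (qasym q R (1 + n0) 0 (n0 + 1)) * site1 1 0 ((Dmat Ψ)⁻¹))

/-- The generators of the characteristic subalgebra: all elements
`α(Y^{(k)}) = Tr_F(1,…,k)(Y^{(k)} M_{\overline{1}}⋯M_{\overline{k}})`, `k ≥ 1`. -/
def charSet {K : Type*} [Field K] {A : Type*} [Ring A] [Algebra K A] {N : ℕ}
    (R F Ψ : M2 N K) (M : Matrix (Fin N) (Fin N) A) : Set A :=
  { x : A | ∃ (v : ℕ) (Y : FreeAlgebra K (Fin v)),
      x = qtrAll (Dmat Ψ)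
        (evalY (R.map (algebraMap K A)) 0 Y *
          MbarSeg (v + 1) (F.map (algebraMap K A)) ((F⁻¹).map (algebraMap K A)) M 0 (v + 1)) }

end

theorem site_one {A : Type*} [Ring A] {N : ℕ} (m i : ℕ) :
    site m i (1 : M2 N A) = 1 := by
  ext a b
  rw [Matrix.one_apply]
  unfold site
  split_ifs with h hoff hab hab
  · subst hab
    rw [Matrix.one_apply_eq, mul_one]
  · rw [Matrix.one_apply_ne, zero_mul]
    intro hi
    rw [Prod.mk.injEq] at hi
    refine hab (funext fun j => ?_)
    by_cases hj : (j : ℕ) = i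
    · obtain rfl : j = ⟨i, Nat.lt_of_succ_lt h⟩ := Fin.ext hj
      exact hi.1
    by_cases hj' : (j : ℕ) = i + 1
    · obtain rfl : j = ⟨i + 1, h⟩ := Fin.ext hj'
      exact hi.2
    exact hoff j hj hj'
  · exact absurd (fun j _ _ => congrFun hab j) hoff
  · exact mul_zero _
  · rfl
  · rfl

theorem site_mul {A : Type*} [Ring A] {N : ℕ} (m i : ℕ) (X Y : M2 N A) :
    site m i (X * Y) = site m i X * site m i Y := by
  by_cases h : i + 1 < m
  swap
  · have hone (Z : M2 N A) : site m i Z = 1 := by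
      ext a b
      simp [site, h, Matrix.one_apply]
    simp [hone]
  ext a b
  simp only [site, h, dite_true, Matrix.mul_apply, Finset.sum_mul]
  set i₀ : Fin m := ⟨i, Nat.lt_of_succ_lt h⟩ with hi₀
  set i₁ : Fin m := ⟨i + 1, h⟩ with hi₁
  have hne : i₀ ≠ i₁ := by simp [hi₀, hi₁]
  let g : Fin N × Fin N → Fin m → Fin N := fun p =>
    Function.update (Function.update a i₀ p.1) i₁ p.2
  have g₀ (p) : g p i₀ = p.1 := by simp [g, hne]
  have g₁ (p) : g p i₁ = p.2 := by simp [g]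
  have goff (p) (j : Fin m) (hj : (j : ℕ) ≠ i) (hj' : (j : ℕ) ≠ i + 1) : g p j = a j := by
    have hj₀ : j ≠ i₀ := fun e => hj (congrArg Fin.val e)
    have hj₁ : j ≠ i₁ := fun e => hj' (congrArg Fin.val e)
    simp [g, hj₀, hj₁]
  refine Finset.sum_of_injOn g ?_ (fun _ _ => Finset.mem_coe.2 (Finset.mem_univ _)) ?_ ?_
  · intro p _ q _ hpq
    exact Prod.ext (by rw [← g₀ p, hpq, g₀]) (by rw [← g₁ p, hpq, g₁])
  · intro c _ hc
    rw [if_neg, mul_zero, zero_mul]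
    intro hac
    refine hc ⟨(c i₀, c i₁), by simp, funext fun j => ?_⟩
    by_cases hj : (j : ℕ) = i
    · obtain rfl : j = i₀ := Fin.ext hj
      exact g₀ _
    by_cases hj' : (j : ℕ) = i + 1
    · obtain rfl : j = i₁ := Fin.ext hj'
      exact g₁ _
    rw [goff _ j hj hj', hac j hj hj']
  · intro p _
    have hag : ∀ j : Fin m, (j : ℕ) ≠ i → (j : ℕ) ≠ i + 1 → a j = g p j :=
      fun j hj hj' => (goff p j hj hj').symm
    have hgb : (∀ j : Fin m, (j : ℕ) ≠ i → (j : ℕ) ≠ i + 1 → g p j = b j) ↔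
        ∀ j : Fin m, (j : ℕ) ≠ i → (j : ℕ) ≠ i + 1 → a j = b j :=
      forall_congr' fun j => forall_congr' fun hj => forall_congr' fun hj' => by
        rw [goff p j hj hj']
    simp only [g₀, g₁, hgb]
    rw [if_pos hag, mul_one, mul_assoc]

/-- `site m i` as a monoid homomorphism. -/
def siteHom {A : Type*} [Ring A] {N : ℕ} (m i : ℕ) : M2 N A →* Op N A m where
  toFun := site m i
  map_one' := site_one m i
  map_mul' := site_mul m i

theorem isUnit_site {A : Type*} [Ring A] {N : ℕ} (m i : ℕ) {X : M2 N A} (hX : IsUnit X) :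
    IsUnit (site m i X) :=
  hX.map (siteHom m i)

section Monoid

variable {M : Type*} [Monoid M] {f₁ f₂ r₁ r₂ s₁ s₂ : M}

theorem twist_compat_left (hf₂ : IsUnit f₂) (hs₁ : s₁ * f₁ = f₁ * r₁) (hs₂ : s₂ * f₂ = f₂ * r₂)
    (hf : f₁ * f₂ * f₁ = f₂ * f₁ * f₂) (hrf : r₁ * f₂ * f₁ = f₂ * f₁ * r₂) :
    s₁ * f₂ * f₁ = f₂ * f₁ * s₂ := by
  refine hf₂.mul_right_cancel ?_
  calc s₁ * f₂ * f₁ * f₂ = s₁ * (f₂ * f₁ * f₂) := by simp only [mul_assoc]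
    _ = s₁ * f₁ * (f₂ * f₁) := by rw [← hf]; simp only [mul_assoc]
    _ = f₁ * (r₁ * f₂ * f₁) := by rw [hs₁]; simp only [mul_assoc]
    _ = f₁ * f₂ * f₁ * r₂ := by rw [hrf]; simp only [mul_assoc]
    _ = f₂ * f₁ * (f₂ * r₂) := by rw [hf]; simp only [mul_assoc]
    _ = f₂ * f₁ * s₂ * f₂ := by rw [← hs₂]; simp only [mul_assoc]

theorem twist_compat_right (hf₁ : IsUnit f₁) (hs₁ : s₁ * f₁ = f₁ * r₁) (hs₂ : s₂ * f₂ = f₂ * r₂)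
    (hf : f₁ * f₂ * f₁ = f₂ * f₁ * f₂) (hfr : f₁ * f₂ * r₁ = r₂ * f₁ * f₂) :
    f₁ * f₂ * s₁ = s₂ * f₁ * f₂ := by
  refine hf₁.mul_right_cancel ?_
  calc f₁ * f₂ * s₁ * f₁ = f₁ * f₂ * (s₁ * f₁) := by simp only [mul_assoc]
    _ = f₁ * f₂ * f₁ * r₁ := by rw [hs₁]; simp only [mul_assoc]
    _ = f₂ * (f₁ * f₂ * r₁) := by rw [hf]; simp only [mul_assoc]
    _ = f₂ * r₂ * (f₁ * f₂) := by rw [hfr]; simp only [mul_assoc]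
    _ = s₂ * (f₂ * f₁ * f₂) := by rw [← hs₂]; simp only [mul_assoc]
    _ = s₂ * f₁ * f₂ * f₁ := by rw [← hf]; simp only [mul_assoc]

theorem twist_triple_mul (hs₁ : s₁ * f₁ = f₁ * r₁) (hrf : r₁ * f₂ * f₁ = f₂ * f₁ * r₂)
    (hfs : f₁ * f₂ * s₁ = s₂ * f₁ * f₂) :
    s₁ * s₂ * s₁ * (f₁ * f₂ * f₁) = f₁ * f₂ * f₁ * (r₂ * r₁ * r₂) := by
  calc s₁ * s₂ * s₁ * (f₁ * f₂ * f₁) = s₁ * s₂ * (s₁ * f₁) * (f₂ * f₁) := by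
        simp only [mul_assoc]
    _ = s₁ * s₂ * f₁ * (r₁ * f₂ * f₁) := by rw [hs₁]; simp only [mul_assoc]
    _ = s₁ * (s₂ * f₁ * f₂) * (f₁ * r₂) := by rw [hrf]; simp only [mul_assoc]
    _ = s₁ * f₁ * (f₂ * (s₁ * f₁) * r₂) := by rw [← hfs]; simp only [mul_assoc]
    _ = f₁ * (r₁ * f₂ * f₁) * (r₁ * r₂) := by rw [hs₁]; simp only [mul_assoc]
    _ = f₁ * f₂ * f₁ * (r₂ * r₁ * r₂) := by rw [hrf]; simp only [mul_assoc]

theorem twist_braid (hf₁ : IsUnit f₁) (hf₂ : IsUnit f₂)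
    (hs₁ : s₁ * f₁ = f₁ * r₁) (hs₂ : s₂ * f₂ = f₂ * r₂)
    (hr : r₁ * r₂ * r₁ = r₂ * r₁ * r₂) (hf : f₁ * f₂ * f₁ = f₂ * f₁ * f₂)
    (hrf : r₁ * f₂ * f₁ = f₂ * f₁ * r₂) (hfr : f₁ * f₂ * r₁ = r₂ * f₁ * f₂) :
    s₁ * s₂ * s₁ = s₂ * s₁ * s₂ := by
  refine ((hf₁.mul hf₂).mul hf₁).mul_right_cancel ?_
  rw [twist_triple_mul hs₁ hrf (twist_compat_right hf₁ hs₁ hs₂ hf hfr), ← hr, hf,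
    twist_triple_mul hs₂ hfr.symm (twist_compat_left hf₂ hs₁ hs₂ hf hrf).symm]

end Monoid

/-- If `R̂, F̂` are compatible R-matrices, then the twist
`R̂^F := F̂ R̂ F̂⁻¹` satisfies the Yang–Baxter equation on `V^{⊗3}`, and the pair
`(R̂^F, F̂)` is again a pair of compatible R-matrices. -/
theorem twist_compatible {K : Type} [Field K] {N : ℕ}
    (R F : M2 N K) (hR : IsUnit R) (hF : IsUnit F) (h : Compatible R F) :
    YB (F * R * F⁻¹) ∧ IsUnit (F * R * F⁻¹) ∧ Compatible (F * R * F⁻¹) F := by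
  obtain ⟨hYR, hYF, hRF, hFR⟩ := h
  have hs (i : ℕ) : site 3 i (F * R * F⁻¹) * site 3 i F = site 3 i F * site 3 i R := by
    rw [← site_mul, ← site_mul,
      Matrix.nonsing_inv_mul_cancel_right _ _ ((Matrix.isUnit_iff_isUnit_det F).1 hF)]
  have hF₁ : IsUnit (site 3 0 F) := isUnit_site 3 0 hF
  have hF₂ : IsUnit (site 3 1 F) := isUnit_site 3 1 hF
  have hYB : YB (F * R * F⁻¹) := twist_braid hF₁ hF₂ (hs 0) (hs 1) hYR hYF hRF hFR
  exact ⟨hYB, (hF.mul hR).mul (Matrix.isUnit_nonsing_inv_iff.2 hF), hYB, hYF,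
    twist_compat_left hF₂ (hs 0) (hs 1) hYF hRF, twist_compat_right hF₁ (hs 0) (hs 1) hYF hFR⟩

end CHN
end

section
/- Let R̂ and F̂ be compatible R-matrices with F̂ closed, and let D be the associated matrix. Then the double twist R̂^{FF} := F̂(F̂R̂F̂^{-1})F̂^{-1} satisfies (R̂^{FF})₁ D₁ D₂ = D₁ D₂ R̂₁ on V⊗V, where D_i denotes D acting in the i-th tensor factor. -/
/-! Common definitions for quantum matrix algebras `M(R̂,F̂)` in the sense of
Isaev–Ogievetsky–Pyatov, "On quantum matrix algebras satisfying the
Cayley-Hamilton-Newton identities".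

We model operators on `V^{⊗m}` (where `dim V = N`) as matrices indexed by
multi-indices `Fin m → Fin N`; entries are taken in a (possibly
noncommutative) unital associative algebra `A` over a field `K`.
Sites (tensor factors) are numbered starting from `0`, so the paper's
`X_i` is `site m (i-1) X`, and the paper's `M_{\overline{k}}` is
`Mbar m F F⁻¹ M (k-1)`. -/

namespace CHN

section Lifts

variable {K : Type*} [Field K] {N m : ℕ}

/-- The operator `A ⊗ 1` on `V^{⊗(m+1)}`. -/
def liftR (A : Op N K m) : Op N K (m + 1) :=
  fun a b => A (Fin.init a) (Fin.init b) * if a (Fin.last m) = b (Fin.last m) then 1 else 0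

/-- The operator `1 ⊗ A` on `V^{⊗(m+1)}`. -/
def liftL (A : Op N K m) : Op N K (m + 1) :=
  fun a b => A (Fin.tail a) (Fin.tail b) * if a 0 = b 0 then 1 else 0

theorem sum_snoc (f : (Fin (m + 1) → Fin N) → K) :
    ∑ a, f a = ∑ v : Fin m → Fin N, ∑ x : Fin N, f (Fin.snoc v x) := by
  rw [← (Fin.snocEquiv fun _ => Fin N).sum_comp, Fintype.sum_prod_type, Finset.sum_comm]
  rfl

theorem sum_cons (f : (Fin (m + 1) → Fin N) → K) :
    ∑ a, f a = ∑ x : Fin N, ∑ v : Fin m → Fin N, f (Fin.cons x v) := by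
  rw [← (Fin.consEquiv fun _ => Fin N).sum_comp, Fintype.sum_prod_type]
  rfl

theorem liftR_mul_snoc (A : Op N K m) (X : Op N K (m + 1)) (a : Fin m → Fin N) (x : Fin N)
    (b : Fin (m + 1) → Fin N) :
    (liftR A * X) (Fin.snoc a x) b = ∑ v, A a v * X (Fin.snoc v x) b := by
  simp [Matrix.mul_apply, sum_snoc, liftR]

theorem mul_liftR_snoc (A : Op N K m) (X : Op N K (m + 1)) (a : Fin m → Fin N) (x : Fin N)
    (b : Fin (m + 1) → Fin N) :
    (X * liftR A) b (Fin.snoc a x) = ∑ v, X b (Fin.snoc v x) * A v a := by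
  simp [Matrix.mul_apply, sum_snoc, liftR]

theorem liftR_mul (A B : Op N K m) : liftR (A * B) = liftR A * liftR B := by
  ext a b
  induction a using Fin.snocCases with | _ a x
  rw [liftR_mul_snoc]
  simp [liftR, Matrix.mul_apply]

theorem liftL_mul (A B : Op N K m) : liftL (A * B) = liftL A * liftL B := by
  ext a b
  simp [liftL, Matrix.mul_apply, sum_cons]

theorem ptr1_liftR_mul (A : Op N K m) (X : Op N K (m + 1)) :
    ptr1 (liftR A * X) = A * ptr1 X := by
  ext a b
  simp only [ptr1, liftR_mul_snoc]
  rw [Finset.sum_comm]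
  simp only [Matrix.mul_apply, ptr1, Finset.mul_sum]

theorem ptr1_mul_liftR (A : Op N K m) (X : Op N K (m + 1)) :
    ptr1 (X * liftR A) = ptr1 X * A := by
  ext a b
  simp only [ptr1, mul_liftR_snoc]
  rw [Finset.sum_comm]
  simp only [Matrix.mul_apply, ptr1, Finset.sum_mul]

theorem site_apply {i : ℕ} (hi : i + 1 < m) (X : M2 N K) {a b : Fin m → Fin N} {P : Prop}
    [Decidable P] (h : (∀ j : Fin m, (j : ℕ) ≠ i → (j : ℕ) ≠ i + 1 → a j = b j) ↔ P) :
    site m i X a b =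
      X (a ⟨i, Nat.lt_of_succ_lt hi⟩, a ⟨i + 1, hi⟩) (b ⟨i, Nat.lt_of_succ_lt hi⟩, b ⟨i + 1, hi⟩) *
        if P then 1 else 0 := by
  rw [site, dif_pos hi, if_congr h rfl rfl]

theorem site1_apply {i : ℕ} (hi : i < m) (X : Matrix (Fin N) (Fin N) K) {a b : Fin m → Fin N}
    {P : Prop} [Decidable P] (h : (∀ j : Fin m, (j : ℕ) ≠ i → a j = b j) ↔ P) :
    site1 m i X a b = X (a ⟨i, hi⟩) (b ⟨i, hi⟩) * if P then 1 else 0 := by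
  rw [site1, dif_pos hi, if_congr h rfl rfl]

theorem liftR_site {i : ℕ} (hi : i + 1 < m) (X : M2 N K) :
    liftR (site m i X) = site (m + 1) i X := by
  ext a b
  have h : (∀ j : Fin (m + 1), (j : ℕ) ≠ i → (j : ℕ) ≠ i + 1 → a j = b j) ↔
      (∀ j : Fin m, (j : ℕ) ≠ i → (j : ℕ) ≠ i + 1 → Fin.init a j = Fin.init b j) ∧
        a (Fin.last m) = b (Fin.last m) := by
    have h1 : m ≠ i := by omega
    have h2 : m ≠ i + 1 := by omega
    simp [Fin.forall_fin_succ', Fin.init, h1, h2]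
  rw [site_apply (by omega) X h, liftR, site_apply hi X Iff.rfl, mul_assoc,
    ite_zero_mul_ite_zero, mul_one]
  rfl

theorem liftR_site1 {i : ℕ} (hi : i < m) (X : Matrix (Fin N) (Fin N) K) :
    liftR (site1 m i X) = site1 (m + 1) i X := by
  ext a b
  have h : (∀ j : Fin (m + 1), (j : ℕ) ≠ i → a j = b j) ↔
      (∀ j : Fin m, (j : ℕ) ≠ i → Fin.init a j = Fin.init b j) ∧
        a (Fin.last m) = b (Fin.last m) := by
    have h1 : m ≠ i := by omega
    simp [Fin.forall_fin_succ', Fin.init, h1]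
  rw [site1_apply (by omega) X h, liftR, site1_apply hi X Iff.rfl, mul_assoc,
    ite_zero_mul_ite_zero, mul_one]
  rfl

theorem liftL_site {i : ℕ} (hi : i + 1 < m) (X : M2 N K) :
    liftL (site m i X) = site (m + 1) (i + 1) X := by
  ext a b
  have h : (∀ j : Fin (m + 1), (j : ℕ) ≠ i + 1 → (j : ℕ) ≠ i + 1 + 1 → a j = b j) ↔
      (∀ j : Fin m, (j : ℕ) ≠ i → (j : ℕ) ≠ i + 1 → Fin.tail a j = Fin.tail b j) ∧
        a 0 = b 0 := by
    simp [Fin.forall_fin_succ, Fin.tail, and_comm]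
  rw [site_apply (by omega) X h, liftL, site_apply hi X Iff.rfl, mul_assoc,
    ite_zero_mul_ite_zero, mul_one]
  rfl

theorem site1_last_snoc (D : Matrix (Fin N) (Fin N) K) (a b : Fin m → Fin N) (x y : Fin N) :
    site1 (m + 1) m D (Fin.snoc a x) (Fin.snoc b y) = D x y * if a = b then 1 else 0 := by
  have h : (⟨m, m.lt_succ_self⟩ : Fin (m + 1)) = Fin.last m := rfl
  have h' (j : Fin m) : (j : ℕ) ≠ m := j.isLt.ne
  simp [site1, Fin.forall_fin_succ', h, h', funext_iff]

theorem site_last_snoc (X : M2 N K) (a b : Fin m → Fin N) (x y z w : Fin N) :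
    site (m + 2) m X (Fin.snoc (Fin.snoc a x : Fin (m + 1) → Fin N) y)
        (Fin.snoc (Fin.snoc b z : Fin (m + 1) → Fin N) w) =
      X (x, y) (z, w) * if a = b then 1 else 0 := by
  have h : (⟨m + 1, (m + 1).lt_succ_self⟩ : Fin (m + 2)) = Fin.last (m + 1) := rfl
  have h₂ : (⟨m, by omega⟩ : Fin (m + 2)) = (Fin.last m).castSucc := rfl
  have h' (j : Fin m) : (j : ℕ) ≠ m := j.isLt.ne
  have h'' (j : Fin m) : (j : ℕ) ≠ m + 1 := (Nat.lt_succ_of_lt j.isLt).ne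
  simp [site, Fin.forall_fin_succ', h, h₂, h', h'', funext_iff]

theorem commute_liftR_site1 (A : Op N K m) (D : Matrix (Fin N) (Fin N) K) :
    liftR A * site1 (m + 1) m D = site1 (m + 1) m D * liftR A := by
  ext a b
  induction a using Fin.snocCases with | _ a x
  induction b using Fin.snocCases with | _ b y
  rw [liftR_mul_snoc, mul_liftR_snoc]
  simp [site1_last_snoc, mul_comm]

/-- The two sides of the skew inverse relation can be exchanged. -/
theorem IsClosedPair.swap {F Ψ : M2 N K} (hΨ : IsClosedPair F Ψ) (g f g' f' : Fin N) :
    ∑ c, ∑ a, F (g, c) (f, a) * Ψ (a, f') (c, g') = if g = g' ∧ f = f' then 1 else 0 := by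
  let A : M2 N K := fun p q => Ψ (p.1, q.2) (p.2, q.1)
  let B : M2 N K := fun p q => F (p.1, q.2) (p.2, q.1)
  have hAB : A * B = 1 := by
    ext ⟨a, c⟩ ⟨d, b⟩
    rw [Matrix.mul_apply, Fintype.sum_prod_type, Finset.sum_comm]
    simpa [A, B, Matrix.one_apply, eq_comm (a := b)] using hΨ a b c d
  have hBA : B * A = 1 := mul_eq_one_comm.mp hAB
  have h := congrFun (congrFun hBA (g, f)) (g', f')
  rw [Matrix.mul_apply, Fintype.sum_prod_type, Finset.sum_comm] at h
  simpa [A, B, Matrix.one_apply] using h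

theorem IsClosedPair.eq_zero {F Ψ : M2 N K} (hΨ : IsClosedPair F Ψ) {Y : Fin N → Fin N → K}
    (hY : ∀ x z, ∑ y, ∑ w, F (x, y) (z, w) * Y y w = 0) (b d : Fin N) : Y b d = 0 := by
  have h : ∑ f, ∑ g, Ψ (d, f) (b, g) * ∑ y, ∑ w, F (g, y) (f, w) * Y y w = Y b d := by
    calc _ = ∑ y, ∑ w, (∑ f, ∑ g, Ψ (d, f) (b, g) * F (g, y) (f, w)) * Y y w := by
          simp only [Finset.mul_sum, Finset.sum_mul, ← Fintype.sum_prod_type', mul_assoc]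
          exact Fintype.sum_equiv
            ⟨fun p => (p.2.2.1, p.2.2.2, p.1, p.2.1), fun p => (p.2.2.1, p.2.2.2, p.1, p.2.1),
              fun _ => rfl, fun _ => rfl⟩ _ _ fun _ => rfl
      _ = Y b d := by simp [hΨ d _ b _, ite_and]
  rw [← h]
  simp [hY]

theorem ptr1_site_mul_site1 {F Ψ : M2 N K} (hΨ : IsClosedPair F Ψ) :
    ptr1 (site (m + 2) m F * site1 (m + 2) (m + 1) (Dmat Ψ)) = 1 := by
  ext a b
  induction a using Fin.snocCases with | _ a x
  induction b using Fin.snocCases with | _ b y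
  have h : ∑ c, ∑ d, F (x, c) (y, d) * Dmat Ψ d c = if x = y then 1 else 0 := by
    calc _ = ∑ s, ∑ c, ∑ d, F (x, c) (y, d) * Ψ (d, s) (c, s) := by
          simp only [Dmat, Finset.mul_sum, ← Fintype.sum_prod_type']
          exact Fintype.sum_equiv ⟨fun p => (p.2.2, p.1, p.2.1), fun p => (p.2.1, p.2.2, p.1),
              fun _ => rfl, fun _ => rfl⟩ _ _ fun _ => rfl
      _ = _ := by simp [hΨ.swap, ite_and, eq_comm (a := x)]
  simp [ptr1, Matrix.mul_apply, sum_snoc, site1_last_snoc, site_last_snoc, h,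
    Matrix.one_apply, Fin.snoc_inj, ite_and]

theorem site_two_mul (X Y : M2 N K) : site 2 0 (X * Y) = site 2 0 X * site 2 0 Y := by
  ext a b
  simp [site, Matrix.mul_apply, sum_cons, Fintype.sum_prod_type, Fin.forall_fin_succ]

theorem site_two_one : site 2 0 (1 : M2 N K) = 1 := by
  ext a b
  simp [site, Fin.forall_fin_succ, Matrix.one_apply, funext_iff]

theorem ptr1_ptr1_apply (Z : Op N K 4) (a b c d : Fin N) :
    ptr1 (ptr1 Z) ![a, b] ![c, d] = ∑ x, ∑ y, Z ![a, b, x, y] ![c, d, x, y] := by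
  have h (p q r s : Fin N) :
      (Fin.snoc (Fin.snoc ![p, q] r : Fin 3 → Fin N) s : Fin 4 → Fin N) = ![p, q, r, s] := by
    ext i
    fin_cases i <;> rfl
  simp only [ptr1, ← h]

theorem sum_four (f : (Fin 4 → Fin N) → K) :
    ∑ e, f e = ∑ a, ∑ b, ∑ c, ∑ d, f ![a, b, c, d] := by
  simp only [sum_cons, Fintype.sum_unique]
  rfl

theorem site_zero_apply (X : M2 N K) (a b c d p q r s : Fin N) :
    site 4 0 X ![a, b, c, d] ![p, q, r, s] = X (a, b) (p, q) * if c = r ∧ d = s then 1 else 0 := by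
  have h : (∀ j : Fin 4, (j : ℕ) ≠ 0 → (j : ℕ) ≠ 0 + 1 →
      ![a, b, c, d] j = ![p, q, r, s] j) ↔ c = r ∧ d = s := by
    simp [Fin.forall_fin_succ]
  exact site_apply (by norm_num) X h

theorem site_zero_mul_apply (X : M2 N K) (Z : Op N K 4) (a b c d : Fin N) (e : Fin 4 → Fin N) :
    (site 4 0 X * Z) ![a, b, c, d] e = ∑ p, ∑ q, X (a, b) (p, q) * Z ![p, q, c, d] e := by
  simp [Matrix.mul_apply, sum_four, site_zero_apply, ite_and]

theorem site_one_apply (X : M2 N K) (a b c d p q r s : Fin N) :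
    site 4 1 X ![a, b, c, d] ![p, q, r, s] = X (b, c) (q, r) * if a = p ∧ d = s then 1 else 0 := by
  have h : (∀ j : Fin 4, (j : ℕ) ≠ 1 → (j : ℕ) ≠ 1 + 1 →
      ![a, b, c, d] j = ![p, q, r, s] j) ↔ a = p ∧ d = s := by
    simp [Fin.forall_fin_succ]
  exact site_apply (by norm_num) X h

theorem site_one_mul_apply (X : M2 N K) (Z : Op N K 4) (a b c d : Fin N) (e : Fin 4 → Fin N) :
    (site 4 1 X * Z) ![a, b, c, d] e = ∑ p, ∑ q, X (b, c) (p, q) * Z ![a, p, q, d] e := by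
  simp [Matrix.mul_apply, sum_four, site_one_apply, ite_and]

theorem site_two_apply (X : M2 N K) (a b c d p q r s : Fin N) :
    site 4 2 X ![a, b, c, d] ![p, q, r, s] = X (c, d) (r, s) * if a = p ∧ b = q then 1 else 0 := by
  have h : (∀ j : Fin 4, (j : ℕ) ≠ 2 → (j : ℕ) ≠ 2 + 1 →
      ![a, b, c, d] j = ![p, q, r, s] j) ↔ a = p ∧ b = q := by
    simp [Fin.forall_fin_succ]
  exact site_apply (by norm_num) X h

theorem site_two_mul_apply (X : M2 N K) (Z : Op N K 4) (a b c d : Fin N) (e : Fin 4 → Fin N) :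
    (site 4 2 X * Z) ![a, b, c, d] e = ∑ p, ∑ q, X (c, d) (p, q) * Z ![a, b, p, q] e := by
  simp [Matrix.mul_apply, sum_four, site_two_apply, ite_and]

open scoped Kronecker in
theorem site_kronecker (D : Matrix (Fin N) (Fin N) K) :
    site (m + 2) m (D ⊗ₖ D) = site1 (m + 2) m D * site1 (m + 2) (m + 1) D := by
  ext a b
  induction a using Fin.snocCases with | _ a x
  induction b using Fin.snocCases with | _ b y
  induction a using Fin.snocCases with | _ a z
  induction b using Fin.snocCases with | _ b w
  rw [← liftR_site1 (Nat.lt_succ_self m), liftR_mul_snoc]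
  simp [site1_last_snoc, site_last_snoc]

theorem commute_site_zero_two (X Y : M2 N K) :
    site 4 0 X * site 4 2 Y = site 4 2 Y * site 4 0 X := by
  ext a b
  obtain ⟨a₀, a₁, a₂, a₃, rfl⟩ : ∃ p q r s, a = ![p, q, r, s] :=
    ⟨a 0, a 1, a 2, a 3, by ext i; fin_cases i <;> rfl⟩
  obtain ⟨b₀, b₁, b₂, b₃, rfl⟩ : ∃ p q r s, b = ![p, q, r, s] :=
    ⟨b 0, b 1, b 2, b 3, by ext i; fin_cases i <;> rfl⟩
  rw [site_zero_mul_apply, site_two_mul_apply]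
  simp [site_zero_apply, site_two_apply, ite_and, mul_comm]

/-- The braiding of `V ⊗ V` with `V ⊗ V` built from `F`. -/
def blockBraid (F : M2 N K) : Op N K 4 :=
  site 4 1 F * site 4 0 F * site 4 2 F * site 4 1 F

/-- The map `X ↦ Tr_{34}(F₂F₁F₃F₂ X₃)` on operators on `V ⊗ V`. -/
def blockTrace (F X : M2 N K) : Op N K 2 :=
  ptr1 (ptr1 (blockBraid F * site 4 2 X))

theorem blockTrace_sub (F X Y : M2 N K) :
    blockTrace F (X - Y) = blockTrace F X - blockTrace F Y := by
  have h : site 4 2 (X - Y) = site 4 2 X - site 4 2 Y := by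
    ext a b
    simp [site]
    split_ifs <;> simp
  ext a b
  simp [blockTrace, h, mul_sub, ptr1]

theorem blockTrace_injective {F Ψ : M2 N K} (hΨ : IsClosedPair F Ψ) :
    Function.Injective (blockTrace F) := by
  suffices ∀ X, blockTrace F X = 0 → X = 0 by
    intro X Y h
    exact sub_eq_zero.mp (this _ (by rw [blockTrace_sub, h, sub_self]))
  intro X hX
  have key (a₁ a₂ b₁ b₂ : Fin N) : ∑ p, ∑ r, F (a₁, p) (b₁, r) *
      ∑ a₃, ∑ q, F (a₂, a₃) (p, q) * ∑ s, ∑ w, F (r, s) (b₂, w) *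
        ∑ a₄, ∑ u, F (q, a₄) (s, u) * X (w, u) (a₃, a₄) = 0 := by
    have h := congrFun (congrFun hX ![a₁, a₂]) ![b₁, b₂]
    simp only [blockTrace, blockBraid, ptr1_ptr1_apply, mul_assoc, site_one_mul_apply,
      site_zero_mul_apply, site_two_mul_apply, site_two_apply] at h
    simp [ite_and] at h
    rw [← h]
    simp only [Finset.mul_sum, ← Fintype.sum_prod_type']
    refine Fintype.sum_equiv
      ⟨fun ⟨p, r, a₃, q, s, w, a₄, u⟩ => (a₃, a₄, p, q, r, s, u, w),
        fun ⟨a₃, a₄, p, q, r, s, u, w⟩ => (p, r, a₃, q, s, w, a₄, u),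
        fun _ => rfl, fun _ => rfl⟩ _ _ fun _ => ?_
    dsimp
    ring
  ext ⟨w, u⟩ ⟨a₃, a₄⟩
  exact hΨ.eq_zero (Y := fun a₄ u => X (w, u) (a₃, a₄)) (fun q s => hΨ.eq_zero
    (Y := fun s w => ∑ a₄, ∑ u, F (q, a₄) (s, u) * X (w, u) (a₃, a₄)) (fun r b₂ => hΨ.eq_zero
      (Y := fun a₃ q => ∑ s, ∑ w, F (r, s) (b₂, w) *
        ∑ a₄, ∑ u, F (q, a₄) (s, u) * X (w, u) (a₃, a₄)) (fun a₂ p => hΨ.eq_zero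
          (Y := fun p r => ∑ a₃, ∑ q, F (a₂, a₃) (p, q) * ∑ s, ∑ w, F (r, s) (b₂, w) *
            ∑ a₄, ∑ u, F (q, a₄) (s, u) * X (w, u) (a₃, a₄))
          (fun a₁ b₁ => key a₁ a₂ b₁ b₂) p r) a₃ q) s w) a₄ u

section Compatible

variable {R F : M2 N K}

theorem Compatible.site_four (h : Compatible R F) :
    (site 4 0 R * site 4 1 F * site 4 0 F = site 4 1 F * site 4 0 F * site 4 1 R ∧
      site 4 1 R * site 4 2 F * site 4 1 F = site 4 2 F * site 4 1 F * site 4 2 R) ∧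
    (site 4 0 F * site 4 1 F * site 4 0 R = site 4 1 R * site 4 0 F * site 4 1 F ∧
      site 4 1 F * site 4 2 F * site 4 1 R = site 4 2 R * site 4 1 F * site 4 2 F) := by
  obtain ⟨-, -, h₁, h₂⟩ := h
  have hR₀ (X : M2 N K) : liftR (site 3 0 X) = site 4 0 X := liftR_site (by norm_num) X
  have hR₁ (X : M2 N K) : liftR (site 3 1 X) = site 4 1 X := liftR_site (by norm_num) X
  have hL₀ (X : M2 N K) : liftL (site 3 0 X) = site 4 1 X := liftL_site (by norm_num) X
  have hL₁ (X : M2 N K) : liftL (site 3 1 X) = site 4 2 X := liftL_site (by norm_num) X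
  refine ⟨⟨?_, ?_⟩, ?_, ?_⟩
  · simpa only [liftR_mul, hR₀, hR₁] using congrArg liftR h₁
  · simpa only [liftL_mul, hL₀, hL₁] using congrArg liftL h₁
  · simpa only [liftR_mul, hR₀, hR₁] using congrArg liftR h₂
  · simpa only [liftL_mul, hL₀, hL₁] using congrArg liftL h₂

theorem Compatible.site_zero_mul_blockBraid (h : Compatible R F) :
    site 4 0 R * blockBraid F = blockBraid F * site 4 2 R := by
  obtain ⟨⟨h₁, h₂⟩, -⟩ := h.site_four
  calc _ = site 4 0 R * site 4 1 F * site 4 0 F * (site 4 2 F * site 4 1 F) := by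
        simp only [blockBraid, mul_assoc]
    _ = site 4 1 F * site 4 0 F * (site 4 1 R * site 4 2 F * site 4 1 F) := by
        rw [h₁]; simp only [mul_assoc]
    _ = _ := by rw [h₂]; simp only [blockBraid, mul_assoc]

theorem Compatible.site_two_mul_blockBraid (h : Compatible R F) :
    site 4 2 R * blockBraid F = blockBraid F * site 4 0 R := by
  obtain ⟨-, h₁, h₂⟩ := h.site_four
  have hF : blockBraid F = site 4 1 F * site 4 2 F * (site 4 0 F * site 4 1 F) := by
    rw [blockBraid, mul_assoc (site 4 1 F), commute_site_zero_two]
    simp only [mul_assoc]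
  calc _ = site 4 2 R * site 4 1 F * site 4 2 F * (site 4 0 F * site 4 1 F) := by
        simp only [hF, mul_assoc]
    _ = site 4 1 F * site 4 2 F * (site 4 1 R * site 4 0 F * site 4 1 F) := by
        rw [← h₂]; simp only [mul_assoc]
    _ = _ := by rw [← h₁, hF]; simp only [mul_assoc]

theorem liftR_liftR_site_two (X : M2 N K) : liftR (liftR (site 2 0 X)) = site 4 0 X := by
  rw [liftR_site (by norm_num), liftR_site (by norm_num)]

theorem site_four_two_mul (X Y : M2 N K) : site 4 2 (X * Y) = site 4 2 X * site 4 2 Y := by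
  have h (Z : M2 N K) : site 4 2 Z = liftL (liftL (site 2 0 Z)) := by
    rw [liftL_site (by norm_num), liftL_site (by norm_num)]
  rw [h, h, h, site_two_mul, liftL_mul, liftL_mul]

theorem ptr1_ptr1_mul_site_two (Z : Op N K 4) (Y : M2 N K) :
    ptr1 (ptr1 (Z * site 4 2 Y)) = ptr1 (ptr1 (site 4 2 Y * Z)) := by
  ext a b
  obtain ⟨a₀, a₁, rfl⟩ : ∃ p q, a = ![p, q] := ⟨a 0, a 1, by ext i; fin_cases i <;> rfl⟩
  obtain ⟨b₀, b₁, rfl⟩ : ∃ p q, b = ![p, q] := ⟨b 0, b 1, by ext i; fin_cases i <;> rfl⟩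
  simp only [ptr1_ptr1_apply, site_two_mul_apply]
  simp only [Matrix.mul_apply, sum_four, site_two_apply]
  simp only [ite_and, mul_ite, mul_one, mul_zero, Finset.sum_ite_irrel, Finset.sum_const_zero,
    Finset.sum_ite_eq', Finset.mem_univ, if_true, ← Fintype.sum_prod_type']
  exact Fintype.sum_equiv ⟨fun t => (t.2.2.1, t.2.2.2, t.1, t.2.1),
    fun t => (t.2.2.1, t.2.2.2, t.1, t.2.1), fun _ => rfl, fun _ => rfl⟩ _ _ fun _ => mul_comm _ _

theorem Compatible.blockTrace_mul_left (h : Compatible R F) (X : M2 N K) :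
    blockTrace F (R * X) = site 2 0 R * blockTrace F X := by
  rw [blockTrace, site_four_two_mul, ← mul_assoc, ← h.site_zero_mul_blockBraid, mul_assoc,
    ← liftR_liftR_site_two, ptr1_liftR_mul, ptr1_liftR_mul, blockTrace]

theorem Compatible.blockTrace_mul_right (h : Compatible R F) (X : M2 N K) :
    blockTrace F (X * R) = blockTrace F X * site 2 0 R := by
  rw [blockTrace, site_four_two_mul, ← mul_assoc, ptr1_ptr1_mul_site_two, ← mul_assoc,
    h.site_two_mul_blockBraid, mul_assoc, commute_site_zero_two, ← mul_assoc,
    ← liftR_liftR_site_two, ptr1_mul_liftR, ptr1_mul_liftR, blockTrace]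

open scoped Kronecker in
theorem blockTrace_kronecker {Ψ : M2 N K} (hF : YB F) (hΨ : IsClosedPair F Ψ) :
    blockTrace F (Dmat Ψ ⊗ₖ Dmat Ψ) = site 2 0 F * site 2 0 F := by
  have h₀ : site 4 0 F = liftR (site 3 0 F) := (liftR_site (by norm_num) F).symm
  have h₁ : site 4 1 F = liftR (site 3 1 F) := (liftR_site (by norm_num) F).symm
  have h₂ : site1 4 2 (Dmat Ψ) = liftR (site1 3 2 (Dmat Ψ)) :=
    (liftR_site1 (by norm_num) _).symm
  have h₃ : site 3 0 F = liftR (site 2 0 F) := (liftR_site (by norm_num) F).symm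
  have h₄ : ptr1 (blockBraid F * site 4 2 (Dmat Ψ ⊗ₖ Dmat Ψ)) =
      site 3 1 F * site 3 0 F * (site 3 1 F * site1 3 2 (Dmat Ψ)) := by
    calc _ = ptr1 (liftR (site 3 1 F * site 3 0 F) *
            (site 4 2 F * (liftR (site 3 1 F * site1 3 2 (Dmat Ψ)) * site1 4 3 (Dmat Ψ)))) := by
          rw [site_kronecker, blockBraid, h₀, h₁, h₂]
          simp only [liftR_mul, mul_assoc]
      _ = _ := by
          rw [commute_liftR_site1, ← mul_assoc (site 4 2 F), ptr1_liftR_mul, ptr1_mul_liftR,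
            ptr1_site_mul_site1 hΨ, one_mul]
  calc _ = ptr1 (liftR (site 2 0 F) * (site 3 1 F * (liftR (site 2 0 F) *
            site1 3 2 (Dmat Ψ)))) := by
        rw [blockTrace, h₄, ← mul_assoc, ← hF, ← h₃]
        simp only [mul_assoc]
    _ = _ := by
        rw [commute_liftR_site1, ← mul_assoc (site 3 1 F), ptr1_liftR_mul, ptr1_mul_liftR,
          ptr1_site_mul_site1 hΨ, one_mul]

open scoped Kronecker in
theorem Compatible.commute_twisted_kronecker {Ψ : M2 N K} (h : Compatible R F) (hF : IsUnit F)
    (hΨ : IsClosedPair F Ψ) :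
    R * (F⁻¹ * (Dmat Ψ ⊗ₖ Dmat Ψ) * F⁻¹) = F⁻¹ * (Dmat Ψ ⊗ₖ Dmat Ψ) * F⁻¹ * R := by
  have hdet := (Matrix.isUnit_iff_isUnit_det F).mp hF
  have hYB : YB F := h.2.1
  have hFF : Compatible F F := ⟨hYB, hYB, hYB, hYB⟩
  have hl : site 2 0 F⁻¹ * site 2 0 F = 1 := by
    rw [← site_two_mul, Matrix.nonsing_inv_mul _ hdet, site_two_one]
  have hr : site 2 0 F * site 2 0 F⁻¹ = 1 := by
    rw [← site_two_mul, Matrix.mul_nonsing_inv _ hdet, site_two_one]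
  have hone : blockTrace F (F⁻¹ * (Dmat Ψ ⊗ₖ Dmat Ψ) * F⁻¹) = 1 := by
    set X := F⁻¹ * (Dmat Ψ ⊗ₖ Dmat Ψ) * F⁻¹ with hX
    have hFXF : F * X * F = Dmat Ψ ⊗ₖ Dmat Ψ := by
      rw [hX, mul_assoc, Matrix.nonsing_inv_mul_cancel_right _ _ hdet,
        Matrix.mul_nonsing_inv_cancel_left _ _ hdet]
    have hsq := blockTrace_kronecker hYB hΨ
    rw [← hFXF, hFF.blockTrace_mul_right, hFF.blockTrace_mul_left] at hsq
    calc _ = site 2 0 F⁻¹ * (site 2 0 F * blockTrace F X * site 2 0 F) * site 2 0 F⁻¹ := by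
          rw [mul_assoc, mul_assoc _ (site 2 0 F), hr, mul_one, ← mul_assoc, hl, one_mul]
      _ = 1 := by rw [hsq, ← mul_assoc, hl, one_mul, hr]
  apply blockTrace_injective hΨ
  rw [h.blockTrace_mul_left, h.blockTrace_mul_right, hone, one_mul, mul_one]

end Compatible

end Lifts

/-- For compatible R-matrices `R̂, F̂` with `F̂` closed (with
closedness witness `Ψ` and associated matrix `D = Dmat Ψ`), the double twist
`R̂^{FF} = F̂(F̂R̂F̂⁻¹)F̂⁻¹` satisfies `(R̂^{FF})₁ D₁ D₂ = D₁ D₂ R̂₁` on `V ⊗ V`. -/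
theorem double_twist_D {K : Type} [Field K] {N : ℕ}
    (R F Ψ : M2 N K) (hR : IsUnit R) (hF : IsUnit F)
    (h : Compatible R F) (hΨ : IsClosedPair F Ψ) :
    site 2 0 (RFF R F) * site1 2 0 (Dmat Ψ) * site1 2 1 (Dmat Ψ) =
      site1 2 0 (Dmat Ψ) * site1 2 1 (Dmat Ψ) * site 2 0 R := by
  have hdet := (Matrix.isUnit_iff_isUnit_det F).mp hF
  have hYB : YB F := h.2.1
  have hFF : Compatible F F := ⟨hYB, hYB, hYB, hYB⟩
  have hRD := h.commute_twisted_kronecker hF hΨ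
  have hFD := hFF.commute_twisted_kronecker hF hΨ
  set T := Matrix.kroneckerMap (· * ·) (Dmat Ψ) (Dmat Ψ)
  have hcomm : T * F⁻¹ = F⁻¹ * T := by
    rwa [mul_assoc, Matrix.mul_nonsing_inv_cancel_left _ _ hdet, ← mul_assoc,
      Matrix.nonsing_inv_mul_cancel_right _ _ hdet] at hFD
  have hX : F⁻¹ * T * F⁻¹ = F⁻¹ * F⁻¹ * T := by rw [mul_assoc, hcomm, ← mul_assoc]
  have key : RFF R F * T = T * R := by
    calc RFF R F * T = F * (F * (R * (F⁻¹ * F⁻¹ * T))) := by simp only [RFF, mul_assoc]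
      _ = F * (F * (F⁻¹ * (F⁻¹ * (T * R)))) := by rw [← hX, hRD, hX]; simp only [mul_assoc]
      _ = T * R := by
        rw [Matrix.mul_nonsing_inv_cancel_left _ _ hdet,
          Matrix.mul_nonsing_inv_cancel_left _ _ hdet]
  have hsite : site 2 0 T = site1 2 0 (Dmat Ψ) * site1 2 1 (Dmat Ψ) := site_kronecker _
  rw [mul_assoc, ← hsite, ← site_two_mul, ← site_two_mul, key]

end CHN
end
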